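/- (Abstract form of Theorem 3.3.) Let J be a finite index set with an involution σ : J → J, let j₀ ∈ J satisfy σ(j₀) = j₀, and let b : J → ℂ satisfy b(σ(j)) = conj(b(j)) for all j. For each i ∈ {0,…,t} and j ∈ J let A^i_j be a complex n_i×n_i matrix with A^i_{σ(j)} = (A^i_j)⋆ (conjugate transpose) for all j. Define v_ℂ := sup { λ ∈ ℝ : there exist complex Hermitian PSD matrices H^i (i = 0,…,t) such that for all j ∈ J, ∑_{i=0}^t ⟨A^i_j, H^i⟩ + (if j = j₀ then λ else 0) = b(j) }, and v_ℝ := sup { λ ∈ ℝ : there exist real matrices X1^i, X2^i, X3^i with X^i = [[X1^i, X3^i], [(X3^i)ᵀ, X2^i]] symmetric PSD (i = 0,…,t) such that for all j ∈ J, ∑_{i=0}^t ( ⟨(A^i_j)_R, X1^i+X2^i⟩ − ⟨(A^i_j)_I, X3^i−(X3^i)ᵀ⟩ ) + (if j = j₀ then λ else 0) = Re(b(j)), and for all j ∈ J with σ(j) ≠ j, ∑_{i=0}^t ( ⟨(A^i_j)_R, X3^i−(X3^i)ᵀ⟩ + ⟨(A^i_j)_I, X1^i+X2^i⟩ ) =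 Im(b(j)) }. Then v_ℂ = v_ℝ. -/

import Mathlib

open Matrix ComplexOrder

section ComplexReal

variable {m n : Type*} [Fintype m] [Fintype n]

open scoped MatrixOrder Matrix.Norms.L2Operator in
theorem Matrix.PosSemidef.exists_eq_conjTranspose_mul_self {𝕜 : Type*} [RCLike 𝕜]
    {M : Matrix n n 𝕜} (hM : M.PosSemidef) : ∃ B : Matrix n n 𝕜, M = Bᴴ * B := by
  classical
  exact CStarAlgebra.nonneg_iff_eq_star_mul_self.mp hM.nonneg

theorem Matrix.re_trace_transpose_mul (A H : Matrix m n ℂ) :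
    ((Aᵀ * H).trace).re =
      ((A.map Complex.re)ᵀ * H.map Complex.re).trace -
        ((A.map Complex.im)ᵀ * H.map Complex.im).trace := by
  simp [Matrix.trace, Matrix.mul_apply, Finset.sum_sub_distrib]

theorem Matrix.im_trace_transpose_mul (A H : Matrix m n ℂ) :
    ((Aᵀ * H).trace).im =
      ((A.map Complex.re)ᵀ * H.map Complex.im).trace +
        ((A.map Complex.im)ᵀ * H.map Complex.re).trace := by
  simp [Matrix.trace, Matrix.mul_apply, Finset.sum_add_distrib]

theorem Matrix.IsHermitian.im_trace_transpose_mul_eq_zero {A H : Matrix n n ℂ}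
    (hA : A.IsHermitian) (hH : H.IsHermitian) : ((Aᵀ * H).trace).im = 0 := by
  rw [← Complex.conj_eq_iff_im]
  change star _ = _
  rw [← Matrix.trace_conjTranspose, Matrix.conjTranspose_mul, hH.eq, hA.transpose.eq,
    Matrix.trace_mul_comm]

/-- The real symmetric embedding of a positive semidefinite complex matrix is positive
semidefinite. -/
theorem Matrix.PosSemidef.fromBlocks_re_im {H : Matrix n n ℂ} (hH : H.PosSemidef) :
    (Matrix.fromBlocks (H.map Complex.re) (H.map Complex.im)
      (H.map Complex.im)ᵀ (H.map Complex.re)).PosSemidef := by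
  classical
  obtain ⟨B, rfl⟩ := hH.exists_eq_conjTranspose_mul_self
  convert Matrix.posSemidef_conjTranspose_mul_self
    (Matrix.fromBlocks (B.map Complex.re) (B.map Complex.im)
      (-B.map Complex.im) (B.map Complex.re)) using 1
  ext (i | i) (j | j) <;>
    simp [Matrix.mul_apply, ← Finset.sum_add_distrib, ← sub_eq_add_neg,
      ← Finset.sum_sub_distrib] <;>
    exact Finset.sum_congr rfl fun k _ => by ring

/-- Compressing a positive semidefinite real block matrix gives a positive semidefinite complex
matrix. -/
theorem Matrix.PosSemidef.complex_of_fromBlocks {X₁ X₂ X₃ : Matrix n n ℝ}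
    (hX : (Matrix.fromBlocks X₁ X₃ X₃ᵀ X₂).PosSemidef) :
    (Matrix.of fun i j => (⟨(X₁ + X₂) i j, (X₃ - X₃ᵀ) i j⟩ : ℂ)).PosSemidef := by
  classical
  obtain ⟨C, hC⟩ := hX.exists_eq_conjTranspose_mul_self
  convert Matrix.posSemidef_conjTranspose_mul_self
    (Matrix.of fun k j => (⟨C k (Sum.inl j), C k (Sum.inr j)⟩ : ℂ)) using 1
  have h₁ (i j) := congrFun (congrFun hC (Sum.inl i)) (Sum.inl j)
  have h₂ (i j) := congrFun (congrFun hC (Sum.inr i)) (Sum.inr j)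
  have h₃ (i j) := congrFun (congrFun hC (Sum.inl i)) (Sum.inr j)
  simp only [Matrix.fromBlocks_apply₁₁, Matrix.fromBlocks_apply₁₂, Matrix.fromBlocks_apply₂₂,
    Matrix.mul_apply, Matrix.conjTranspose_apply, star_trivial] at h₁ h₂ h₃
  ext i j
  apply Complex.ext
  · simp only [Matrix.of_apply, Matrix.add_apply, h₁, h₂, Matrix.mul_apply,
      Matrix.conjTranspose_apply, Complex.re_sum, ← Finset.sum_add_distrib]
    exact Finset.sum_congr rfl fun k _ => by simp
  · simp only [Matrix.of_apply, Matrix.sub_apply, Matrix.transpose_apply, h₃, Matrix.mul_apply,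
      Matrix.conjTranspose_apply, Complex.im_sum, ← Finset.sum_sub_distrib]
    exact Finset.sum_congr rfl fun k _ => by simp; ring

end ComplexReal

open Matrix ComplexOrder

/-- Abstract form of Theorem 3.3: the complex SDP with constraints indexed by `J`
(whose data is symmetric under an involution `σ` via conjugate transposes) has the
same optimal value as the real reformulation in which the imaginary-part equations
at `σ`-fixed indices are omitted. -/
theorem stmt_16 (t : ℕ) (J : Type) [Fintype J] [DecidableEq J]
    (σ : J → J) (hσ : Function.Involutive σ) (j₀ : J) (hj₀ : σ j₀ = j₀)
    (b : J → ℂ) (hb : ∀ j, b (σ j) = star (b j))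
    (nn : Fin (t + 1) → ℕ)
    (A : (i : Fin (t + 1)) → J → Matrix (Fin (nn i)) (Fin (nn i)) ℂ)
    (hA : ∀ i j, A i (σ j) = (A i j)ᴴ) :
    sSup (Real.toEReal '' {lam : ℝ |
        ∃ H : (i : Fin (t + 1)) → Matrix (Fin (nn i)) (Fin (nn i)) ℂ,
        (∀ i, (H i).PosSemidef) ∧
        ∀ j, (∑ i, ((A i j)ᵀ * H i).trace) +
              (if j = j₀ then (lam : ℂ) else 0) = b j}) =
    sSup (Real.toEReal '' {lam : ℝ |
        ∃ X1 X2 X3 : (i : Fin (t + 1)) → Matrix (Fin (nn i)) (Fin (nn i)) ℝ,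
        (∀ i, (Matrix.fromBlocks (X1 i) (X3 i) (X3 i)ᵀ (X2 i)).PosSemidef) ∧
        (∀ j, (∑ i, ((((A i j).map Complex.re)ᵀ * (X1 i + X2 i)).trace -
                     (((A i j).map Complex.im)ᵀ * (X3 i - (X3 i)ᵀ)).trace)) +
              (if j = j₀ then lam else 0) = (b j).re) ∧
        (∀ j, σ j ≠ j →
            (∑ i, ((((A i j).map Complex.re)ᵀ * (X3 i - (X3 i)ᵀ)).trace +
                   (((A i j).map Complex.im)ᵀ * (X1 i + X2 i)).trace)) = (b j).im)}) := by
  congr 2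
  ext lam
  constructor
  · rintro ⟨H, hH, hEq⟩
    have hIm (i) : ((1 / 2 : ℝ) • (H i).map Complex.im) - ((1 / 2 : ℝ) • (H i).map Complex.im)ᵀ =
        (H i).map Complex.im := by
      ext k l
      have h := congrArg Complex.im ((hH i).isHermitian.apply k l)
      simp only [Complex.star_def, Complex.conj_im] at h
      simp
      linarith
    have hRe (i) : ((1 / 2 : ℝ) • (H i).map Complex.re) + ((1 / 2 : ℝ) • (H i).map Complex.re) =
        (H i).map Complex.re := by
      rw [← add_smul]
      norm_num
    refine ⟨fun i => (1 / 2 : ℝ) • (H i).map Complex.re,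
      fun i => (1 / 2 : ℝ) • (H i).map Complex.re,
      fun i => (1 / 2 : ℝ) • (H i).map Complex.im, fun i => ?_, fun j => ?_, fun j _ => ?_⟩
    · rw [Matrix.transpose_smul, ← Matrix.fromBlocks_smul]
      exact (hH i).fromBlocks_re_im.smul (by norm_num)
    · simp only [hIm, hRe, ← Matrix.re_trace_transpose_mul, ← hEq j]
      split_ifs <;> simp
    · simp only [hIm, hRe, ← Matrix.im_trace_transpose_mul, ← hEq j]
      split_ifs <;> simp
  · rintro ⟨X₁, X₂, X₃, hX, hRe, hIm⟩
    have hH (i) := (hX i).complex_of_fromBlocks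
    refine ⟨_, hH, fun j => Complex.ext ?_ ?_⟩
    · rw [← hRe j, Complex.add_re, Complex.re_sum]
      simp only [Matrix.re_trace_transpose_mul]
      congr 1
      split_ifs <;> simp
    · have hlam : (if j = j₀ then (lam : ℂ) else 0).im = 0 := by split_ifs <;> simp
      rw [Complex.add_im, Complex.im_sum, hlam, add_zero]
      by_cases hj : σ j = j
      · have hbj : (b j).im = 0 := by
          rw [← Complex.conj_eq_iff_im]
          simpa [hj] using (hb j).symm
        rw [hbj]
        refine Finset.sum_eq_zero fun i _ => ?_
        refine Matrix.IsHermitian.im_trace_transpose_mul_eq_zero ?_ (hH i).isHermitian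
        exact (hA i j).symm.trans (by rw [hj])
      · rw [← hIm j hj]
        simp only [Matrix.im_trace_transpose_mul]
        rfl
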